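/- The string w(𝒢) can be partitioned into words from 𝒟(𝒢) (i.e., w(𝒢) ∈ 𝒟(𝒢)*) if and only if 𝒢 contains a 4k-clique. -/

import Mathlib

/-- The alphabet `Σ = {1,…,N} ∪ {$, #, γ, μ, α, β}`: numeric symbols together
with six distinct special symbols. -/
inductive Letter where
  | num : ℕ → Letter
  | dollar : Letter
  | hash : Letter
  | gam : Letter
  | mu : Letter
  | alp : Letter
  | bet : Letter
deriving DecidableEq

/-- The string of numeric symbols `a·(a+1)⋯(a+len−1)`. -/
def nums (a len : ℕ) : List Letter := (List.range len).map (fun t => Letter.num (a + t))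

/-- `Low(b) = 1·2⋯(b−1)` (empty if `b = 1`). -/
def low (b : ℕ) : List Letter := nums 1 (b - 1)

/-- `High(b) = b·(b+1)⋯N`. -/
def high (N b : ℕ) : List Letter := nums b (N + 1 - b)

/-- The string `1·2⋯N`. -/
def full (N : ℕ) : List Letter := nums 1 N

/-- For a `2k`-clique `A = {a_1 < ⋯ < a_{2k}}`, the gadget string
`w_A = $·(1 2⋯N)·#·a_1·#·(1 2⋯N)·#·a_2·#·⋯·#·a_{2k}·#·(1 2⋯N)·$`.
A vertex `a : Fin n` is written as the numeric symbol `a+1 ∈ {1,…,n}`. -/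
def wordA (n N : ℕ) (A : Finset (Fin n)) : List Letter :=
  Letter.dollar :: (full N ++
    (A.sort (· ≤ ·)).flatMap (fun a => Letter.hash :: Letter.num (a.val + 1) :: Letter.hash :: full N) ++
    [Letter.dollar])

/-- `s` belongs to the Kleene star of the dictionary `D`:
`s` is a concatenation of finitely many (possibly zero) words of `D`. -/
def InStar (D : Set (List Letter)) (s : List Letter) : Prop :=
  ∃ fs : List (List Letter), (∀ f ∈ fs, f ∈ D) ∧ fs.flatten = s


/-- `f₀(s₁s₂⋯sₗ) = (α s₁ β)(α s₂ β)⋯(α sₗ β)`. -/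
def f0 (s : List Letter) : List Letter :=
  s.flatMap (fun c => [Letter.alp, c, Letter.bet])

/-- `f₁(s₁s₂⋯sₗ) = (s₁ β α)(s₂ β α)⋯(sₗ β α)`. -/
def f1 (s : List Letter) : List Letter :=
  s.flatMap (fun c => [c, Letter.bet, Letter.alp])

/-- The dictionary `𝒟(𝒢)` of the lower-bound reduction (items (1)–(5)). -/
def dictG (n k N : ℕ) (G : SimpleGraph (Fin n)) (code : Finset (Fin n) → ℕ) :
    Set (List Letter) :=
  -- (1)
  {w | ∃ B : Finset (Fin n), G.IsNClique k B ∧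
        (w = f1 (Letter.dollar :: low (code B)) ∨ w = f1 (high N (code B)))} ∪
  -- (2)
  {w | ∃ (B : Finset (Fin n)) (i : Fin n), G.IsNClique k B ∧ i ∉ B ∧
        (∀ v ∈ B, G.Adj i v) ∧
        w = f1 (high N (code B) ++
                Letter.hash :: Letter.num (i.val + 1) :: Letter.hash :: low (code B))} ∪
  -- (3)
  {w | ∃ B C : Finset (Fin n), G.IsNClique k B ∧ G.IsNClique k C ∧
        Disjoint B C ∧ (∀ b ∈ B, ∀ c ∈ C, G.Adj b c) ∧
        w = f1 (high N (code B) ++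
                Letter.dollar :: Letter.gam :: Letter.dollar :: low (code C))} ∪
  -- (4)
  {w | ∃ σ : Letter,
        ((∃ t : ℕ, 1 ≤ t ∧ t ≤ N ∧ σ = Letter.num t) ∨
          σ = Letter.dollar ∨ σ = Letter.hash ∨ σ = Letter.gam ∨ σ = Letter.mu) ∧
        (w = [Letter.alp, σ, Letter.bet] ∨ w = [Letter.bet, Letter.alp, σ])} ∪
  -- (5)
  {[Letter.alp, Letter.mu, Letter.bet, Letter.alp],
   [Letter.dollar, Letter.bet, Letter.alp, Letter.mu],
   [Letter.bet, Letter.mu, Letter.mu]}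

/-- The string `w(𝒢) = (∏_A f₀(μ·w_A·γ·w_A·μ))·μμ`, where the concatenation is
over the list `As` of all `2k`-cliques of `𝒢` in a fixed order. -/
def wordG (n N : ℕ) (As : List (Finset (Fin n))) : List Letter :=
  (As.flatMap (fun A =>
      f0 (Letter.mu :: wordA n N A ++ Letter.gam :: wordA n N A ++ [Letter.mu]))) ++
    [Letter.mu, Letter.mu]

/-! ### Kleene star -/

theorem InStar.nil (D : Set (List Letter)) : InStar D [] := ⟨[], by simp, rfl⟩

theorem InStar.cons {D : Set (List Letter)} {w t : List Letter} (hw : w ∈ D) (ht : InStar D t) :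
    InStar D (w ++ t) := by
  obtain ⟨fs, hfs, rfl⟩ := ht
  exact ⟨w :: fs, by simpa using ⟨hw, hfs⟩, rfl⟩

/-- A nonempty string in the Kleene star starts with a nonempty word of the dictionary. -/
theorem InStar.exists_word {D : Set (List Letter)} {s : List Letter} (hs : InStar D s)
    (hne : s ≠ []) : ∃ w t, w ∈ D ∧ w ≠ [] ∧ s = w ++ t ∧ InStar D t := by
  obtain ⟨fs, hfs, rfl⟩ := hs
  induction fs with
  | nil => simp at hne
  | cons f fs ih =>
    have htail : ∀ g ∈ fs, g ∈ D := fun g hg => hfs g (List.mem_cons_of_mem _ hg)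
    by_cases hf : f = []
    · subst hf
      exact ih htail (by simpa using hne)
    · exact ⟨f, fs.flatten, hfs f (by simp), hf, rfl, fs, htail, rfl⟩

/-! ### Numeric blocks -/

theorem nums_succ (a l : ℕ) : nums a (l + 1) = Letter.num a :: nums (a + 1) l := by
  simp only [nums, List.range_succ_eq_map, List.map_cons, List.map_map, Nat.add_zero]
  congr 1
  apply List.map_congr_left
  intro t _
  simp only [Function.comp, Letter.num.injEq]
  omega

theorem nums_add (a l m : ℕ) : nums a (l + m) = nums a l ++ nums (a + l) m := by
  simp [nums, List.range_add, Function.comp_def, Nat.add_assoc]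

theorem low_append_high {N b : ℕ} (h1 : 1 ≤ b) (h2 : b ≤ N) : low b ++ high N b = full N := by
  have h := nums_add 1 (b - 1) (N + 1 - b)
  rw [show b - 1 + (N + 1 - b) = N by omega, show 1 + (b - 1) = b by omega] at h
  exact h.symm

theorem high_eq_cons {N b : ℕ} (h : b ≤ N) :
    high N b = Letter.num b :: nums (b + 1) (N - b) := by
  rw [high, show N + 1 - b = N - b + 1 by omega, nums_succ]

theorem full_eq_cons {N : ℕ} (h : 1 ≤ N) : full N = Letter.num 1 :: nums 2 (N - 1) := by
  rw [full, show N = N - 1 + 1 by omega, nums_succ]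
  rfl

theorem low_eq_nil_or_cons (b : ℕ) : low b = [] ∨ ∃ l, low b = Letter.num 1 :: l := by
  unfold low
  cases b - 1 with
  | zero => exact Or.inl rfl
  | succ m => exact Or.inr ⟨_, nums_succ 1 m⟩

/-! ### Strings after the letter `α`

After the initial `α` of the encoding of `u` has been consumed, the string that remains to be
parsed is `afterAlp u`. -/

/-- The string `f₀(u)·μμ` without its first letter. -/
def afterAlp (u : List Letter) : List Letter := (f0 u ++ [Letter.mu, Letter.mu]).tail

theorem f0_cons (c : Letter) (u : List Letter) :
    f0 (c :: u) = Letter.alp :: c :: Letter.bet :: f0 u := rfl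

theorem f1_cons (c : Letter) (u : List Letter) :
    f1 (c :: u) = c :: Letter.bet :: Letter.alp :: f1 u := rfl

theorem f0_append (u v : List Letter) : f0 (u ++ v) = f0 u ++ f0 v := by simp [f0]

theorem afterAlp_cons (c : Letter) (u : List Letter) :
    afterAlp (c :: u) = c :: Letter.bet :: (f0 u ++ [Letter.mu, Letter.mu]) := rfl

theorem f0_append_eq_afterAlp {u : List Letter} (hu : u ≠ []) :
    f0 u ++ [Letter.mu, Letter.mu] = Letter.alp :: afterAlp u := by
  cases u with
  | nil => contradiction
  | cons c u => rfl

theorem afterAlp_ne_nil (u : List Letter) : afterAlp u ≠ [] := by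
  cases u <;> simp [afterAlp, f0]

theorem afterAlp_append (v : List Letter) {u : List Letter} (hu : u ≠ []) :
    afterAlp (v ++ u) = f1 v ++ afterAlp u := by
  induction v with
  | nil => rfl
  | cons c v ih =>
    rw [List.cons_append, afterAlp_cons, f0_append_eq_afterAlp (by simp [hu]), ih, f1_cons]
    rfl

theorem eq_append_of_f1_append_eq_afterAlp {v t u : List Letter} (h : f1 v ++ t = afterAlp u) :
    ∃ u', u = v ++ u' ∧ t = afterAlp u' := by
  induction v generalizing u with
  | nil => exact ⟨u, rfl, h⟩
  | cons c v ih =>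
    rw [f1_cons] at h
    cases u with
    | nil => simp [afterAlp, f0] at h
    | cons d u =>
      rw [afterAlp_cons] at h
      simp only [List.cons_append, List.cons.injEq, true_and] at h
      obtain ⟨rfl, h⟩ := h
      cases u with
      | nil => simp [f0] at h
      | cons e u =>
        rw [f0_append_eq_afterAlp (by simp)] at h
        obtain ⟨u', h1, h2⟩ := ih (List.cons.inj h).2
        exact ⟨u', by rw [h1]; rfl, h2⟩

/-! ### Words of the dictionary -/

/-- The strings `v` such that `f₁(v)` is a word of the dictionary of type (1), (2) or (3). -/
inductive IsBaseWord {n : ℕ} (k N : ℕ) (G : SimpleGraph (Fin n)) (code : Finset (Fin n) → ℕ) :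
    List Letter → Prop
  | dollarLow (B : Finset (Fin n)) (hB : G.IsNClique k B) :
      IsBaseWord k N G code (Letter.dollar :: low (code B))
  | high (B : Finset (Fin n)) (hB : G.IsNClique k B) : IsBaseWord k N G code (high N (code B))
  | hash (B : Finset (Fin n)) (i : Fin n) (hB : G.IsNClique k B) (hi : i ∉ B)
      (hadj : ∀ v ∈ B, G.Adj i v) :
      IsBaseWord k N G code (_root_.high N (code B) ++
        Letter.hash :: Letter.num (i.val + 1) :: Letter.hash :: low (code B))
  | gam (B C : Finset (Fin n)) (hB : G.IsNClique k B) (hC : G.IsNClique k C)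
      (hBC : Disjoint B C) (hadj : ∀ b ∈ B, ∀ c ∈ C, G.Adj b c) :
      IsBaseWord k N G code (_root_.high N (code B) ++
        Letter.dollar :: Letter.gam :: Letter.dollar :: low (code C))

/-- The letters `{1,…,N, $, #, γ, μ}`. -/
def IsPlain (N : ℕ) (σ : Letter) : Prop :=
  (∃ t : ℕ, 1 ≤ t ∧ t ≤ N ∧ σ = Letter.num t) ∨
    σ = Letter.dollar ∨ σ = Letter.hash ∨ σ = Letter.gam ∨ σ = Letter.mu

section

variable {n k N : ℕ} {G : SimpleGraph (Fin n)} {code : Finset (Fin n) → ℕ}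

theorem mem_dictG_iff {w : List Letter} :
    w ∈ dictG n k N G code ↔
      (∃ v, IsBaseWord k N G code v ∧ w = f1 v) ∨
      (∃ σ, IsPlain N σ ∧
        (w = [Letter.alp, σ, Letter.bet] ∨ w = [Letter.bet, Letter.alp, σ])) ∨
      w = [Letter.alp, Letter.mu, Letter.bet, Letter.alp] ∨
      w = [Letter.dollar, Letter.bet, Letter.alp, Letter.mu] ∨
      w = [Letter.bet, Letter.mu, Letter.mu] := by
  constructor
  · rintro ((((⟨B, hB, h | h⟩ | ⟨B, i, hB, hi, hadj, h⟩) | ⟨B, C, hB, hC, hBC, hadj, h⟩) | h) | h)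
    · exact Or.inl ⟨_, .dollarLow B hB, h⟩
    · exact Or.inl ⟨_, .high B hB, h⟩
    · exact Or.inl ⟨_, .hash B i hB hi hadj, h⟩
    · exact Or.inl ⟨_, .gam B C hB hC hBC hadj, h⟩
    · exact Or.inr (Or.inl h)
    · exact Or.inr (Or.inr h)
  · rintro (⟨v, hv, rfl⟩ | h | h)
    · cases hv with
      | dollarLow B hB => exact Or.inl (Or.inl (Or.inl (Or.inl ⟨B, hB, Or.inl rfl⟩)))
      | high B hB => exact Or.inl (Or.inl (Or.inl (Or.inl ⟨B, hB, Or.inr rfl⟩)))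
      | hash B i hB hi hadj =>
        exact Or.inl (Or.inl (Or.inl (Or.inr ⟨B, i, hB, hi, hadj, rfl⟩)))
      | gam B C hB hC hBC hadj =>
        exact Or.inl (Or.inl (Or.inr ⟨B, C, hB, hC, hBC, hadj, rfl⟩))
    · exact Or.inl (Or.inr h)
    · exact Or.inr h

theorem IsPlain.dollar : IsPlain N Letter.dollar := Or.inr (Or.inl rfl)
theorem IsPlain.hash : IsPlain N Letter.hash := Or.inr (Or.inr (Or.inl rfl))
theorem IsPlain.gam : IsPlain N Letter.gam := Or.inr (Or.inr (Or.inr (Or.inl rfl)))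
theorem IsPlain.mu : IsPlain N Letter.mu := Or.inr (Or.inr (Or.inr (Or.inr rfl)))

theorem IsPlain.num {t : ℕ} (h1 : 1 ≤ t) (h2 : t ≤ N) : IsPlain N (Letter.num t) :=
  Or.inl ⟨t, h1, h2, rfl⟩

theorem IsPlain.of_mem_full {σ : Letter} (h : σ ∈ full N) : IsPlain N σ := by
  simp only [full, nums, List.mem_map, List.mem_range] at h
  obtain ⟨t, ht, rfl⟩ := h
  exact .num (by omega) (by omega)

theorem IsPlain.of_mem_wordA (hnN : n ≤ N) {A : Finset (Fin n)} {σ : Letter}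
    (h : σ ∈ wordA n N A) : IsPlain N σ := by
  simp only [wordA, List.mem_cons, List.mem_append, List.mem_flatMap, List.not_mem_nil,
    or_false] at h
  rcases h with rfl | (h | ⟨a, _, rfl | rfl | rfl | h⟩) | rfl
  · exact .dollar
  · exact .of_mem_full h
  · exact .hash
  · exact .num (by omega) (by omega)
  · exact .hash
  · exact .of_mem_full h
  · exact .dollar

theorem mu_notMem_wordA (A : Finset (Fin n)) : Letter.mu ∉ wordA n N A := by
  simp [wordA, full, nums]

/-- The first letter of a base word is a number or `$`. -/
theorem IsBaseWord.exists_cons (hcode : ∀ B, G.IsNClique k B → 1 ≤ code B ∧ code B ≤ N)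
    {v : List Letter} (hv : IsBaseWord k N G code v) :
    ∃ c v', v = c :: v' ∧ (c = Letter.dollar ∨ ∃ t, c = Letter.num t) := by
  cases hv with
  | dollarLow B hB => exact ⟨_, _, rfl, Or.inl rfl⟩
  | high B hB => exact ⟨_, _, high_eq_cons (hcode B hB).2, Or.inr ⟨_, rfl⟩⟩
  | hash B i hB => rw [high_eq_cons (hcode B hB).2]; exact ⟨_, _, rfl, Or.inr ⟨_, rfl⟩⟩
  | gam B C hB => rw [high_eq_cons (hcode B hB).2]; exact ⟨_, _, rfl, Or.inr ⟨_, rfl⟩⟩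

/-! ### Parsing forces a clique -/

/-- A parsing of the string after `α` starts with a base word or with `$βαμ`. -/
theorem exists_baseWord_or_of_inStar_afterAlp {u : List Letter}
    (ha : u.head? ≠ some Letter.alp) (hb : u.head? ≠ some Letter.bet)
    (h : InStar (dictG n k N G code) (afterAlp u)) :
    (∃ v u', IsBaseWord k N G code v ∧ u = v ++ u' ∧
      InStar (dictG n k N G code) (afterAlp u')) ∨
    ∃ u', u = Letter.dollar :: Letter.mu :: u' := by
  obtain ⟨w, t, hw, -, hwt, ht⟩ := h.exists_word (afterAlp_ne_nil u)
  rcases mem_dictG_iff.1 hw with ⟨v, hv, rfl⟩ | ⟨σ, -, rfl | rfl⟩ | rfl | rfl | rfl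
  · obtain ⟨u', hu, rfl⟩ := eq_append_of_f1_append_eq_afterAlp hwt.symm
    exact Or.inl ⟨v, u', hv, hu, ht⟩
  all_goals
    rcases u with _ | ⟨c, u⟩
    · simp [afterAlp, f0] at hwt
    · simp only [afterAlp_cons, List.cons_append, List.cons.injEq] at hwt
      simp only [List.head?_cons, ne_eq, Option.some.injEq] at ha hb
      first
      | exact absurd hwt.1 ha
      | exact absurd hwt.1 hb
      | rcases u with _ | ⟨d, u⟩
        · simp [f0] at hwt
        · simp only [f0_cons, List.cons_append, List.cons.injEq] at hwt
          exact Or.inr ⟨u, by rw [hwt.1, hwt.2.2.2.1]⟩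

theorem head_of_inStar_afterAlp (hcode : ∀ B, G.IsNClique k B → 1 ≤ code B ∧ code B ≤ N)
    {u : List Letter} (h : InStar (dictG n k N G code) (afterAlp u))
    (ha : u.head? ≠ some Letter.alp) (hb : u.head? ≠ some Letter.bet) :
    u.head? = some Letter.dollar ∨ ∃ t, u.head? = some (Letter.num t) := by
  rcases exists_baseWord_or_of_inStar_afterAlp ha hb h with ⟨v, u', hv, rfl, -⟩ | ⟨u', rfl⟩
  · obtain ⟨c, v', rfl, hc⟩ := hv.exists_cons hcode
    simpa using hc
  · exact Or.inl rfl

theorem exists_clique_of_inStar_dollar (hN : 1 ≤ N)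
    (hcode : ∀ B, G.IsNClique k B → 1 ≤ code B ∧ code B ≤ N) {x : List Letter}
    (h : InStar (dictG n k N G code) (afterAlp (Letter.dollar :: (full N ++ x)))) :
    ∃ B, G.IsNClique k B ∧
      InStar (dictG n k N G code) (afterAlp (high N (code B) ++ x)) := by
  rcases exists_baseWord_or_of_inStar_afterAlp (by simp) (by simp) h with
    ⟨v, u', hv, he, hu⟩ | ⟨u', he⟩
  · cases hv with
    | dollarLow B hB =>
      rw [← low_append_high (hcode B hB).1 (hcode B hB).2] at he
      simp only [List.cons_append, List.append_assoc, List.cons.injEq, true_and,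
        List.append_cancel_left_eq] at he
      exact ⟨B, hB, he ▸ hu⟩
    | high B hB => simp [high_eq_cons (hcode B hB).2] at he
    | hash B i hB => simp [high_eq_cons (hcode B hB).2] at he
    | gam B C hB => simp [high_eq_cons (hcode B hB).2] at he
  · simp [full_eq_cons hN] at he

/-- Either the high part is a whole word, or it is continued by a word of type (2) or (3). -/
theorem inStar_high_cases (hcode : ∀ B, G.IsNClique k B → 1 ≤ code B ∧ code B ≤ N)
    (hinj : ∀ B C, G.IsNClique k B → G.IsNClique k C → code B = code C → B = C)
    {B : Finset (Fin n)} (hB : G.IsNClique k B) {x : List Letter}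
    (h : InStar (dictG n k N G code) (afterAlp (high N (code B) ++ x))) :
    InStar (dictG n k N G code) (afterAlp x) ∨
    (∃ (i : Fin n) (u' : List Letter), i ∉ B ∧ (∀ v ∈ B, G.Adj i v) ∧
      x = Letter.hash :: Letter.num (i.val + 1) :: Letter.hash :: (low (code B) ++ u') ∧
      InStar (dictG n k N G code) (afterAlp u')) ∨
    (∃ (C : Finset (Fin n)) (u' : List Letter), G.IsNClique k C ∧ Disjoint B C ∧
      (∀ b ∈ B, ∀ c ∈ C, G.Adj b c) ∧
      x = Letter.dollar :: Letter.gam :: Letter.dollar :: (low (code C) ++ u') ∧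
      InStar (dictG n k N G code) (afterAlp u')) := by
  have hBN := (hcode B hB).2
  have same : ∀ B', G.IsNClique k B' → ∀ y z,
      high N (code B) ++ y = high N (code B') ++ z → B' = B ∧ y = z := by
    intro B' hB' y z he
    have hBB' : B' = B := by
      refine hinj _ _ hB' hB ?_
      rw [high_eq_cons hBN, high_eq_cons (hcode B' hB').2] at he
      simp only [List.cons_append, List.cons.injEq, Letter.num.injEq] at he
      exact he.1.symm
    subst hBB'
    exact ⟨rfl, List.append_cancel_left he⟩
  rcases exists_baseWord_or_of_inStar_afterAlp (by simp [high_eq_cons hBN])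
    (by simp [high_eq_cons hBN]) h with ⟨v, u', hv, he, hu⟩ | ⟨u', he⟩
  · cases hv with
    | dollarLow B' hB' => simp [high_eq_cons hBN] at he
    | high B' hB' =>
      obtain ⟨-, rfl⟩ := same B' hB' _ _ he
      exact Or.inl hu
    | hash B' i hB' hi hadj =>
      rw [List.append_assoc] at he
      obtain ⟨rfl, rfl⟩ := same B' hB' _ _ he
      exact Or.inr (Or.inl ⟨i, u', hi, hadj, rfl, hu⟩)
    | gam B' C hB' hC hBC hadj =>
      rw [List.append_assoc] at he
      obtain ⟨rfl, rfl⟩ := same B' hB' _ _ he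
      exact Or.inr (Or.inr ⟨C, u', hC, hBC, hadj, rfl, hu⟩)
  · simp [high_eq_cons hBN] at he

theorem adj_of_inStar_hash (hcode : ∀ B, G.IsNClique k B → 1 ≤ code B ∧ code B ≤ N)
    (hinj : ∀ B C, G.IsNClique k B → G.IsNClique k C → code B = code C → B = C)
    {B : Finset (Fin n)} (hB : G.IsNClique k B) {a : Fin n} {x : List Letter}
    (h : InStar (dictG n k N G code) (afterAlp (high N (code B) ++
      Letter.hash :: Letter.num (a.val + 1) :: Letter.hash :: (full N ++ x)))) :
    (a ∉ B ∧ ∀ v ∈ B, G.Adj a v) ∧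
      InStar (dictG n k N G code) (afterAlp (high N (code B) ++ x)) := by
  rcases inStar_high_cases hcode hinj hB h with h | ⟨i, u', hi, hadj, he, hu⟩ |
    ⟨C, u', _, _, _, he, _⟩
  · simpa using head_of_inStar_afterAlp hcode h (by simp) (by simp)
  · rw [← low_append_high (hcode B hB).1 (hcode B hB).2] at he
    simp only [List.cons.injEq, Letter.num.injEq, Nat.add_right_cancel_iff, true_and,
      List.append_assoc, List.append_cancel_left_eq] at he
    obtain ⟨hai, rfl⟩ := he
    obtain rfl := Fin.ext hai
    exact ⟨⟨hi, hadj⟩, hu⟩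
  · simp at he

theorem adj_of_inStar_flatMap (hcode : ∀ B, G.IsNClique k B → 1 ≤ code B ∧ code B ≤ N)
    (hinj : ∀ B C, G.IsNClique k B → G.IsNClique k C → code B = code C → B = C)
    {B : Finset (Fin n)} (hB : G.IsNClique k B) {l : List (Fin n)} {x : List Letter}
    (h : InStar (dictG n k N G code) (afterAlp (high N (code B) ++
      (l.flatMap (fun a => Letter.hash :: Letter.num (a.val + 1) :: Letter.hash :: full N) ++
        x)))) :
    (∀ a ∈ l, a ∉ B ∧ ∀ v ∈ B, G.Adj a v) ∧
      InStar (dictG n k N G code) (afterAlp (high N (code B) ++ x)) := by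
  induction l with
  | nil => exact ⟨by simp, h⟩
  | cons a l ih =>
    simp only [List.flatMap_cons, List.cons_append, List.append_assoc] at h
    obtain ⟨ha, h⟩ := adj_of_inStar_hash hcode hinj hB h
    obtain ⟨hl, h⟩ := ih h
    exact ⟨List.forall_mem_cons.2 ⟨ha, hl⟩, h⟩

theorem exists_clique_of_inStar_gam (hcode : ∀ B, G.IsNClique k B → 1 ≤ code B ∧ code B ≤ N)
    (hinj : ∀ B C, G.IsNClique k B → G.IsNClique k C → code B = code C → B = C)
    {B : Finset (Fin n)} (hB : G.IsNClique k B) {x : List Letter}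
    (h : InStar (dictG n k N G code) (afterAlp (high N (code B) ++
      Letter.dollar :: Letter.gam :: Letter.dollar :: (full N ++ x)))) :
    ∃ C, G.IsNClique k C ∧ Disjoint B C ∧ (∀ b ∈ B, ∀ c ∈ C, G.Adj b c) ∧
      InStar (dictG n k N G code) (afterAlp (high N (code C) ++ x)) := by
  rcases inStar_high_cases hcode hinj hB h with h | ⟨i, u', _, _, he, _⟩ |
    ⟨C, u', hC, hBC, hadj, he, hu⟩
  · exfalso
    rcases exists_baseWord_or_of_inStar_afterAlp (by simp) (by simp) h with
      ⟨v, u', hv, he, hu⟩ | ⟨u', he⟩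
    · cases hv with
      | dollarLow B hB =>
        rcases low_eq_nil_or_cons (code B) with hl | ⟨l, hl⟩
        · simp only [hl, List.cons_append, List.nil_append, List.cons.injEq, true_and] at he
          subst he
          simpa using head_of_inStar_afterAlp hcode hu (by simp) (by simp)
        · simp [hl] at he
      | high B hB => simp [high_eq_cons (hcode B hB).2] at he
      | hash B i hB => simp [high_eq_cons (hcode B hB).2] at he
      | gam B C hB => simp [high_eq_cons (hcode B hB).2] at he
    · simp at he
  · simp at he
  · rw [← low_append_high (hcode C hC).1 (hcode C hC).2] at he
    simp only [List.cons.injEq, true_and, List.append_assoc, List.append_cancel_left_eq] at he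
    exact ⟨C, hC, hBC, hadj, he ▸ hu⟩

theorem exists_cliques_of_inStar_wordA (hN : 1 ≤ N)
    (hcode : ∀ B, G.IsNClique k B → 1 ≤ code B ∧ code B ≤ N)
    (hinj : ∀ B C, G.IsNClique k B → G.IsNClique k C → code B = code C → B = C)
    {A : Finset (Fin n)} {x : List Letter}
    (h : InStar (dictG n k N G code)
      (afterAlp (wordA n N A ++ Letter.gam :: (wordA n N A ++ x)))) :
    ∃ B C, G.IsNClique k B ∧ G.IsNClique k C ∧ Disjoint B C ∧
      (∀ b ∈ B, ∀ c ∈ C, G.Adj b c) ∧ (∀ a ∈ A, a ∉ B ∧ ∀ v ∈ B, G.Adj a v) ∧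
      (∀ a ∈ A, a ∉ C ∧ ∀ v ∈ C, G.Adj a v) := by
  simp only [wordA, List.cons_append, List.append_assoc, List.nil_append] at h
  obtain ⟨B, hB, h⟩ := exists_clique_of_inStar_dollar hN hcode h
  obtain ⟨hAB, h⟩ := adj_of_inStar_flatMap hcode hinj hB h
  obtain ⟨C, hC, hBC, hadj, h⟩ := exists_clique_of_inStar_gam hcode hinj hB h
  obtain ⟨hAC, -⟩ := adj_of_inStar_flatMap hcode hinj hC h
  simp only [Finset.mem_sort] at hAB hAC
  exact ⟨B, C, hB, hC, hBC, hadj, hAB, hAC⟩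

/-- A parsing of `f₀(u)·μμ` has to use the word `αμβα` at some letter `μ` of `u`. -/
theorem exists_mu_of_inStar (hcode : ∀ B, G.IsNClique k B → 1 ≤ code B ∧ code B ≤ N)
    {u : List Letter}
    (h : InStar (dictG n k N G code) (f0 u ++ [Letter.mu, Letter.mu])) :
    ∃ u₁ u₂, u = u₁ ++ Letter.mu :: u₂ ∧ InStar (dictG n k N G code) (afterAlp u₂) := by
  induction u with
  | nil =>
    obtain ⟨w, t, hw, -, hwt, -⟩ := h.exists_word (by simp)
    rcases mem_dictG_iff.1 hw with ⟨v, hv, rfl⟩ | ⟨σ, -, rfl | rfl⟩ | rfl | rfl | rfl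
    · obtain ⟨c, v', rfl, rfl | ⟨_, rfl⟩⟩ := hv.exists_cons hcode <;> simp [f0, f1] at hwt
    all_goals simp [f0] at hwt
  | cons c u ih =>
    obtain ⟨w, t, hw, -, hwt, ht⟩ := h.exists_word (by simp)
    rcases mem_dictG_iff.1 hw with ⟨v, hv, rfl⟩ | ⟨σ, -, rfl | rfl⟩ | rfl | rfl | rfl
    · obtain ⟨c, v', rfl, rfl | ⟨_, rfl⟩⟩ := hv.exists_cons hcode <;> simp [f0, f1] at hwt
    · simp only [f0_cons, List.cons_append, List.nil_append, List.cons.injEq, true_and] at hwt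
      obtain ⟨rfl, rfl⟩ := hwt
      obtain ⟨u₁, u₂, rfl, hu⟩ := ih ht
      exact ⟨c :: u₁, u₂, rfl, hu⟩
    · simp [f0] at hwt
    · simp only [f0_cons, List.cons_append, List.nil_append, List.cons.injEq, true_and] at hwt
      obtain ⟨rfl, hwt⟩ := hwt
      refine ⟨[], u, rfl, ?_⟩
      rw [afterAlp, hwt]
      exact ht
    · simp [f0] at hwt
    · simp [f0] at hwt

end

/-- What can follow an occurrence of `m` in a product of blocks delimited by `m`. -/
theorem eq_of_append_cons_eq_flatMap {ι τ : Type*} {m : τ} {g : ι → List τ} {l : List ι}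
    (hg : ∀ i ∈ l, m ∉ g i) {u₁ u₂ : List τ}
    (h : l.flatMap (fun i => m :: g i ++ [m]) = u₁ ++ m :: u₂) :
    u₂ = [] ∨ (∃ t, u₂ = m :: t) ∨ ∃ i ∈ l, ∃ t, u₂ = g i ++ m :: t := by
  induction l generalizing u₁ with
  | nil => simp at h
  | cons i l ih =>
    have after : ∀ l' : List ι, u₂ = l'.flatMap (fun i => m :: g i ++ [m]) →
        u₂ = [] ∨ ∃ t, u₂ = m :: t := by
      rintro (_ | ⟨j, l'⟩) rfl
      · exact Or.inl rfl
      · exact Or.inr ⟨_, rfl⟩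
    have tail_case : ∀ c, l.flatMap (fun i => m :: g i ++ [m]) = c ++ m :: u₂ →
        u₂ = [] ∨ (∃ t, u₂ = m :: t) ∨ ∃ j ∈ i :: l, ∃ t, u₂ = g j ++ m :: t := by
      intro c hc
      rcases ih (fun j hj => hg j (List.mem_cons_of_mem _ hj)) hc with h | h | ⟨j, hj, h⟩
      · exact Or.inl h
      · exact Or.inr (Or.inl h)
      · exact Or.inr (Or.inr ⟨j, List.mem_cons_of_mem _ hj, h⟩)
    have head_case : l.flatMap (fun i => m :: g i ++ [m]) = u₂ →
        u₂ = [] ∨ (∃ t, u₂ = m :: t) ∨ ∃ j ∈ i :: l, ∃ t, u₂ = g j ++ m :: t := fun he =>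
      (after l he.symm).imp_right Or.inl
    have hi : m ∉ g i := hg i (by simp)
    rw [List.flatMap_cons] at h
    simp only [List.cons_append, List.append_assoc, List.nil_append] at h
    rcases u₁ with _ | ⟨d, u₁⟩
    · exact Or.inr (Or.inr ⟨i, by simp, _, (List.cons.inj h).2.symm⟩)
    · have h := (List.cons.inj h).2
      rcases List.append_eq_append_iff.1 h with ⟨c, -, hc⟩ | ⟨c, hc', hc⟩
      · rcases c with _ | ⟨e, c⟩
        · exact head_case (List.cons.inj hc).2
        · exact tail_case c (List.cons.inj hc).2
      · rcases c with _ | ⟨e, c⟩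
        · exact head_case (List.cons.inj hc).2.symm
        · obtain rfl := (List.cons.inj hc).1
          exact absurd (by simp [hc']) hi

section

variable {n k N : ℕ} {G : SimpleGraph (Fin n)} {code : Finset (Fin n) → ℕ}

theorem wordG_eq (As : List (Finset (Fin n))) :
    wordG n N As = f0 (As.flatMap fun A => Letter.mu ::
      (wordA n N A ++ Letter.gam :: wordA n N A) ++ [Letter.mu]) ++ [Letter.mu, Letter.mu] := by
  simp only [wordG, f0, List.flatMap_assoc, List.cons_append, List.append_assoc]

theorem exists_cliques_of_inStar_wordG (hN : 1 ≤ N)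
    (hcode : ∀ B, G.IsNClique k B → 1 ≤ code B ∧ code B ≤ N)
    (hinj : ∀ B C, G.IsNClique k B → G.IsNClique k C → code B = code C → B = C)
    {As : List (Finset (Fin n))} (h : InStar (dictG n k N G code) (wordG n N As)) :
    ∃ A ∈ As, ∃ B C, G.IsNClique k B ∧ G.IsNClique k C ∧ Disjoint B C ∧
      (∀ b ∈ B, ∀ c ∈ C, G.Adj b c) ∧ (∀ a ∈ A, a ∉ B ∧ ∀ v ∈ B, G.Adj a v) ∧
      (∀ a ∈ A, a ∉ C ∧ ∀ v ∈ C, G.Adj a v) := by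
  rw [wordG_eq] at h
  obtain ⟨u₁, u₂, he, hu⟩ := exists_mu_of_inStar hcode h
  rcases eq_of_append_cons_eq_flatMap (fun A _ => by simp [mu_notMem_wordA]) he with
    rfl | ⟨t, rfl⟩ | ⟨A, hA, t, rfl⟩
  · simpa using head_of_inStar_afterAlp hcode hu (by simp) (by simp)
  · simpa using head_of_inStar_afterAlp hcode hu (by simp) (by simp)
  · rw [List.append_assoc, List.cons_append] at hu
    exact ⟨A, hA, exists_cliques_of_inStar_wordA hN hcode hinj hu⟩

/-! ### A clique gives a parsing -/

theorem inStar_f0_append {u t : List Letter} (hu : ∀ σ ∈ u, IsPlain N σ)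
    (ht : InStar (dictG n k N G code) t) : InStar (dictG n k N G code) (f0 u ++ t) := by
  induction u with
  | nil => exact ht
  | cons c u ih =>
    exact InStar.cons (w := [Letter.alp, c, Letter.bet])
      (mem_dictG_iff.2 (Or.inr (Or.inl ⟨c, hu c (by simp), Or.inl rfl⟩)))
      (ih fun σ hσ => hu σ (List.mem_cons_of_mem _ hσ))

theorem inStar_bet_cons_f0 {u : List Letter} (hu : ∀ σ ∈ u, IsPlain N σ) :
    InStar (dictG n k N G code) (Letter.bet :: (f0 u ++ [Letter.mu, Letter.mu])) := by
  induction u with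
  | nil =>
    exact InStar.cons (w := [Letter.bet, Letter.mu, Letter.mu])
      (mem_dictG_iff.2 (by simp)) (InStar.nil _)
  | cons c u ih =>
    exact InStar.cons (w := [Letter.bet, Letter.alp, c])
      (mem_dictG_iff.2 (Or.inr (Or.inl ⟨c, hu c (by simp), Or.inr rfl⟩)))
      (ih fun σ hσ => hu σ (List.mem_cons_of_mem _ hσ))

theorem inStar_afterAlp_dollar_mu {u : List Letter} (hu : ∀ σ ∈ u, IsPlain N σ) :
    InStar (dictG n k N G code) (afterAlp (Letter.dollar :: Letter.mu :: u)) :=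
  InStar.cons (w := [Letter.dollar, Letter.bet, Letter.alp, Letter.mu])
    (mem_dictG_iff.2 (by simp)) (inStar_bet_cons_f0 hu)

theorem IsBaseWord.inStar_afterAlp {v u : List Letter} (hv : IsBaseWord k N G code v)
    (hu : u ≠ []) (h : InStar (dictG n k N G code) (afterAlp u)) :
    InStar (dictG n k N G code) (afterAlp (v ++ u)) := by
  rw [afterAlp_append v hu]
  exact InStar.cons (mem_dictG_iff.2 (Or.inl ⟨v, hv, rfl⟩)) h

theorem inStar_afterAlp_flatMap (hcode : ∀ B, G.IsNClique k B → 1 ≤ code B ∧ code B ≤ N)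
    {B : Finset (Fin n)} (hB : G.IsNClique k B) {l : List (Fin n)} {x : List Letter}
    (hl : ∀ a ∈ l, a ∉ B ∧ ∀ v ∈ B, G.Adj a v)
    (h : InStar (dictG n k N G code) (afterAlp (high N (code B) ++ x))) :
    InStar (dictG n k N G code) (afterAlp (high N (code B) ++
      (l.flatMap (fun a => Letter.hash :: Letter.num (a.val + 1) :: Letter.hash :: full N) ++
        x))) := by
  induction l with
  | nil => exact h
  | cons a l ih =>
    have ha := hl a (by simp)
    have := (IsBaseWord.hash (N := N) (code := code) B a hB ha.1 ha.2).inStar_afterAlp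
      (by simp [high_eq_cons (hcode B hB).2]) (ih fun b hb => hl b (List.mem_cons_of_mem _ hb))
    simpa [← low_append_high (hcode B hB).1 (hcode B hB).2] using this

theorem inStar_afterAlp_wordA (hcode : ∀ B, G.IsNClique k B → 1 ≤ code B ∧ code B ≤ N)
    {A B C : Finset (Fin n)} (hB : G.IsNClique k B) (hC : G.IsNClique k C)
    (hBC : Disjoint B C) (hadj : ∀ b ∈ B, ∀ c ∈ C, G.Adj b c)
    (hAB : ∀ a ∈ A, a ∉ B ∧ ∀ v ∈ B, G.Adj a v) (hAC : ∀ a ∈ A, a ∉ C ∧ ∀ v ∈ C, G.Adj a v)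
    {x : List Letter} (hx : ∀ σ ∈ x, IsPlain N σ) :
    InStar (dictG n k N G code)
      (afterAlp (wordA n N A ++ Letter.gam :: (wordA n N A ++ Letter.mu :: x))) := by
  have hBN := hcode B hB
  have hCN := hcode C hC
  have last := (IsBaseWord.high (N := N) (code := code) C hC).inStar_afterAlp (by simp)
    (inStar_afterAlp_dollar_mu hx)
  have second := inStar_afterAlp_flatMap hcode hC (l := A.sort (· ≤ ·)) (by simpa using hAC) last
  have mid := (IsBaseWord.gam (N := N) (code := code) B C hB hC hBC hadj).inStar_afterAlp
    (by simp [high_eq_cons hCN.2]) second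
  rw [List.append_assoc] at mid
  have first := inStar_afterAlp_flatMap hcode hB (l := A.sort (· ≤ ·)) (by simpa using hAB) mid
  have start := (IsBaseWord.dollarLow (N := N) (code := code) B hB).inStar_afterAlp
    (by simp [high_eq_cons hBN.2]) first
  have eB : ∀ y, low (code B) ++ (high N (code B) ++ y) = full N ++ y := fun y => by
    rw [← low_append_high hBN.1 hBN.2, List.append_assoc]
  have eC : ∀ y, low (code C) ++ (high N (code C) ++ y) = full N ++ y := fun y => by
    rw [← low_append_high hCN.1 hCN.2, List.append_assoc]
  simp only [List.cons_append, eB, eC] at start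
  simpa only [wordA, List.cons_append, List.append_assoc, List.nil_append] using start

theorem inStar_wordG (hnN : n ≤ N)
    (hcode : ∀ B, G.IsNClique k B → 1 ≤ code B ∧ code B ≤ N)
    {A B C : Finset (Fin n)} (hB : G.IsNClique k B) (hC : G.IsNClique k C)
    (hBC : Disjoint B C) (hadj : ∀ b ∈ B, ∀ c ∈ C, G.Adj b c)
    (hAB : ∀ a ∈ A, a ∉ B ∧ ∀ v ∈ B, G.Adj a v) (hAC : ∀ a ∈ A, a ∉ C ∧ ∀ v ∈ C, G.Adj a v)
    {As : List (Finset (Fin n))} (hA : A ∈ As) :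
    InStar (dictG n k N G code) (wordG n N As) := by
  have plain : ∀ l : List (Finset (Fin n)), ∀ σ ∈ l.flatMap (fun A => Letter.mu ::
      (wordA n N A ++ Letter.gam :: wordA n N A) ++ [Letter.mu]), IsPlain N σ := by
    intro l σ hσ
    simp only [List.mem_flatMap, List.mem_cons, List.mem_append, List.not_mem_nil,
      or_false] at hσ
    rcases hσ with ⟨A', -, (rfl | h | rfl | h) | rfl⟩
    · exact .mu
    · exact .of_mem_wordA hnN h
    · exact .gam
    · exact .of_mem_wordA hnN h
    · exact .mu
  obtain ⟨l₁, l₂, rfl⟩ := List.append_of_mem hA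
  rw [wordG_eq, List.flatMap_append, f0_append, List.append_assoc]
  refine inStar_f0_append (plain l₁) ?_
  have h := InStar.cons (w := [Letter.alp, Letter.mu, Letter.bet, Letter.alp])
    (mem_dictG_iff.2 (by simp))
    (inStar_afterAlp_wordA hcode hB hC hBC hadj hAB hAC (plain l₂))
  simp only [List.cons_append, List.nil_append] at h
  rw [← f0_append_eq_afterAlp (by simp)] at h
  simpa [f0_cons] using h

/-! ### Splitting cliques -/

theorem isNClique_union {a b : ℕ} {S T : Finset (Fin n)} (hS : G.IsNClique a S)
    (hT : G.IsNClique b T) (hST : ∀ s ∈ S, s ∉ T ∧ ∀ t ∈ T, G.Adj s t) :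
    G.IsNClique (a + b) (S ∪ T) := by
  refine ⟨?_, ?_⟩
  · intro x hx y hy hxy
    simp only [Finset.coe_union, Set.mem_union, Finset.mem_coe] at hx hy
    rcases hx with hx | hx <;> rcases hy with hy | hy
    · exact hS.1 hx hy hxy
    · exact (hST x hx).2 y hy
    · exact ((hST y hy).2 x hx).symm
    · exact hT.1 hx hy hxy
  · rw [Finset.card_union_of_disjoint (Finset.disjoint_left.2 fun s hs => (hST s hs).1),
      hS.2, hT.2]

theorem exists_split_of_isNClique {a b : ℕ} {S : Finset (Fin n)} (hS : G.IsNClique (a + b) S) :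
    ∃ T ⊆ S, ∃ U ⊆ S, G.IsNClique a T ∧ G.IsNClique b U ∧
      ∀ t ∈ T, t ∉ U ∧ ∀ u ∈ U, G.Adj t u := by
  obtain ⟨T, hTS, hT⟩ := Finset.exists_subset_card_eq (show a ≤ S.card by rw [hS.2]; omega)
  refine ⟨T, hTS, S \ T, Finset.sdiff_subset, ⟨hS.1.subset (by simpa using hTS), hT⟩,
    ⟨hS.1.subset (by simp), ?_⟩, fun t ht => ⟨by simp [ht], fun u hu => ?_⟩⟩
  · rw [Finset.card_sdiff_of_subset hTS, hS.2, hT]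
    omega
  · rw [Finset.mem_sdiff] at hu
    exact hS.1 (hTS ht) hu.1 fun h => hu.2 (h ▸ ht)

end

theorem stmt7 (k n : ℕ) (hk : 1 ≤ k) (hn : 1 ≤ n)
    (G : SimpleGraph (Fin n)) (code : Finset (Fin n) → ℕ)
    (hcode_range : ∀ B : Finset (Fin n), G.IsNClique k B → 1 ≤ code B ∧ code B ≤ n ^ k)
    (hcode_inj : ∀ B C : Finset (Fin n),
      G.IsNClique k B → G.IsNClique k C → code B = code C → B = C)
    (As : List (Finset (Fin n))) (hAs_nodup : As.Nodup)
    (hAs : ∀ A : Finset (Fin n), A ∈ As ↔ G.IsNClique (2 * k) A) :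
    InStar (dictG n k (n ^ k) G code) (wordG n (n ^ k) As) ↔
      ∃ S : Finset (Fin n), G.IsNClique (4 * k) S := by
  have hnN : n ≤ n ^ k := Nat.le_self_pow (by omega) n
  constructor
  · intro h
    obtain ⟨A, hA, B, C, hB, hC, hBC, hadj, hAB, hAC⟩ :=
      exists_cliques_of_inStar_wordG (hn.trans hnN) hcode_range hcode_inj h
    have hBC' : G.IsNClique (k + k) (B ∪ C) := isNClique_union hB hC fun b hb =>
      ⟨Finset.disjoint_left.1 hBC hb, hadj b hb⟩
    have hABC := isNClique_union ((hAs A).1 hA) hBC' fun a ha =>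
      ⟨by simp [(hAB a ha).1, (hAC a ha).1], fun t ht =>
        (Finset.mem_union.1 ht).elim ((hAB a ha).2 t) ((hAC a ha).2 t)⟩
    exact ⟨_, by convert hABC using 1; omega⟩
  · rintro ⟨S, hS⟩
    rw [show 4 * k = 2 * k + (k + k) by omega] at hS
    obtain ⟨A, -, T, -, hA, hT, hAT⟩ := exists_split_of_isNClique hS
    obtain ⟨B, hBT, C, hCT, hB, hC, hBC⟩ := exists_split_of_isNClique hT
    exact inStar_wordG hnN hcode_range hB hC (Finset.disjoint_left.2 fun b hb => (hBC b hb).1)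
      (fun b hb => (hBC b hb).2)
      (fun a ha => ⟨fun h => (hAT a ha).1 (hBT h), fun v hv => (hAT a ha).2 v (hBT hv)⟩)
      (fun a ha => ⟨fun h => (hAT a ha).1 (hCT h), fun v hv => (hAT a ha).2 v (hCT hv)⟩)
      ((hAs A).2 hA)
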